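/- For every prime p with 409 < p ≤ 71761, the least primitive root modulo p is strictly less than √p − 2. -/

import Mathlib

/-- `a` is a primitive root modulo `n`: the multiplicative order of `a` mod `n`
equals `φ(n)`, i.e. `a` generates `(ℤ/nℤ)ˣ`. -/
def IsPrimitiveRootMod (a n : ℕ) : Prop :=
  orderOf (a : ZMod n) = Nat.totient n

/-- `a` is the least positive primitive root modulo `n`. -/
def IsLeastPrimitiveRootMod (a n : ℕ) : Prop :=
  0 < a ∧ IsPrimitiveRootMod a n ∧ ∀ b : ℕ, 0 < b → b < a → ¬ IsPrimitiveRootMod b n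

/-- Trial division of `m` by the entries of `L`, evaluating `t` at each divisor found. If `L` is
increasing and contains every prime factor of `m` below some bound for its entries, then the result
`true` means that `t` holds at every prime factor of `m`. -/
def allPrimeFactors (t : ℕ → Bool) : ℕ → List ℕ → ℕ → Bool
  | 0, _, _ => false
  | _ + 1, [], _ => false
  | k + 1, d :: L, m =>
    bif Nat.ble (d * d) m then
      bif Nat.beq (m % d) 0 then t d && allPrimeFactors t k (d :: L) (m / d)
      else allPrimeFactors t k L m
    else Nat.ble m 1 || t m

theorem Nat.Prime.eq_of_dvd_of_lt_mul_self {d m q : ℕ} (hq : q.Prime) (hqm : q ∣ m) (hm : 0 < m)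
    (hmin : ∀ r, r.Prime → r ∣ m → d ≤ r) (hlt : m < d * d) : m = q := by
  obtain ⟨c, rfl⟩ := hqm
  by_cases hc : c = 1
  · simp [hc]
  · obtain ⟨r, hr, hrc⟩ := Nat.exists_prime_and_dvd hc
    have hcd : d ≤ c := (hmin r hr (hrc.mul_left q)).trans
      (Nat.le_of_dvd (Nat.pos_of_mul_pos_left hm) hrc)
    have := Nat.mul_le_mul (hmin q hq (dvd_mul_right q c)) hcd
    omega

theorem of_allPrimeFactors {t : ℕ → Bool} {k N m : ℕ} {L : List ℕ} (hL : L.Pairwise (· < ·))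
    (hpos : ∀ d ∈ L, 0 < d) (hN : ∀ d ∈ L, d ≤ N) (hm : 0 < m)
    (hmem : ∀ q, q.Prime → q ∣ m → q < N → q ∈ L) (h : allPrimeFactors t k L m = true)
    {q : ℕ} (hq : q.Prime) (hqm : q ∣ m) : t q = true := by
  induction k generalizing L m with
  | zero => simp [allPrimeFactors] at h
  | succ k ih =>
    obtain _ | ⟨d, L⟩ := L
    · simp [allPrimeFactors] at h
    have hd : 0 < d := hpos d List.mem_cons_self
    have hmin : ∀ r, r.Prime → r ∣ m → d ≤ r := by
      intro r hr hrm
      by_contra! hrd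
      obtain rfl | hrL :=
        List.mem_cons.1 (hmem r hr hrm (hrd.trans_le (hN d List.mem_cons_self)))
      · exact lt_irrefl _ hrd
      · exact hrd.asymm (List.rel_of_pairwise_cons hL hrL)
    rw [allPrimeFactors] at h
    by_cases hle : d * d ≤ m
    · rw [Nat.ble_eq_true_of_le hle, cond_true] at h
      by_cases hdvd : m % d = 0
      · rw [hdvd, Nat.beq_refl, cond_true, Bool.and_eq_true] at h
        by_cases hqd : q = d
        · exact hqd ▸ h.1
        · obtain ⟨c, rfl⟩ := Nat.dvd_of_mod_eq_zero hdvd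
          rw [Nat.mul_div_cancel_left c hd] at h
          refine ih hL hpos hN (Nat.pos_of_mul_pos_left hm)
            (fun r hr hrc => hmem r hr (hrc.mul_left d)) h.2 ?_
          refine (hq.dvd_mul.1 hqm).resolve_left fun hqd' => hqd ?_
          exact le_antisymm (Nat.le_of_dvd hd hqd') (hmin q hq hqm)
      · have hbeq : Nat.beq (m % d) 0 = false := by
          rw [← Bool.not_eq_true, Nat.beq_eq]; exact hdvd
        rw [hbeq, cond_false] at h
        refine ih hL.of_cons (fun e he => hpos e (List.mem_cons_of_mem d he))
          (fun e he => hN e (List.mem_cons_of_mem d he)) hm (fun r hr hrm hrN => ?_) h hqm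
        refine (List.mem_cons.1 (hmem r hr hrm hrN)).resolve_left fun hrd => hdvd ?_
        exact Nat.mod_eq_zero_of_dvd (hrd ▸ hrm)
    · have hble : Nat.ble (d * d) m = false := by
        rw [← Bool.not_eq_true, Nat.ble_eq]; exact hle
      obtain rfl := hq.eq_of_dvd_of_lt_mul_self hqm hm hmin (not_le.1 hle)
      simp only [hble, cond_false, Bool.or_eq_true, Nat.ble_eq] at h
      exact h.resolve_left hq.one_lt.not_ge

/-- The primes below `278`. -/
def smallPrimes : List ℕ :=
  [2, 3, 5, 7, 11, 13, 17, 19, 23, 29, 31, 37, 41, 43, 47, 53, 59, 61, 67, 71, 73, 79, 83, 89, 97,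
    101, 103, 107, 109, 113, 127, 131, 137, 139, 149, 151, 157, 163, 167, 173, 179, 181, 191, 193,
    197, 199, 211, 223, 227, 229, 233, 239, 241, 251, 257, 263, 269, 271, 277]

theorem smallPrimes_eq : smallPrimes = (List.range 278).filter Nat.Prime := by
  decide +kernel

theorem mem_smallPrimes {q : ℕ} : q ∈ smallPrimes ↔ q < 278 ∧ q.Prime := by
  simp [smallPrimes_eq]

theorem pairwise_smallPrimes : smallPrimes.Pairwise (· < ·) :=
  smallPrimes_eq ▸ List.pairwise_lt_range.filter _

/-- Searches for `b ∈ [a, a + k)` with `(b + 2) ^ 2 < n` such that `b ^ ((n - 1) / q)` is not `1`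
modulo `n` for any prime factor `q` of `n - 1`. -/
def hasSmallGenerator (n : ℕ) : ℕ → ℕ → Bool
  | 0, _ => false
  | k + 1, a =>
    (Nat.blt ((a + 2) * (a + 2)) n &&
      allPrimeFactors (fun q => !Nat.beq (a ^ ((n - 1) / q) % n) 1) 100 smallPrimes (n - 1)) ||
    hasSmallGenerator n k (a + 1)

theorem ZMod.natCast_pow_eq_one_iff {n : ℕ} (hn : 1 < n) (a k : ℕ) :
    (a : ZMod n) ^ k = 1 ↔ a ^ k % n = 1 := by
  have := ZMod.natCast_eq_natCast_iff' (a ^ k) 1 n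
  rwa [Nat.mod_eq_of_lt hn, Nat.cast_pow, Nat.cast_one] at this

theorem isPrimitiveRootMod_of_pow_mod_ne_one {p a : ℕ} (hp : p.Prime) (ha : 0 < a) (hap : a < p)
    (h : ∀ q, q.Prime → q ∣ p - 1 → a ^ ((p - 1) / q) % p ≠ 1) : IsPrimitiveRootMod a p := by
  have := Fact.mk hp
  have ha0 : (a : ZMod p) ≠ 0 := by
    rw [Ne, ZMod.natCast_eq_zero_iff]
    exact Nat.not_dvd_of_pos_of_lt ha hap
  rw [IsPrimitiveRootMod, Nat.totient_prime hp]
  refine orderOf_eq_of_pow_and_pow_div_prime (Nat.sub_pos_of_lt hp.one_lt)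
    (ZMod.pow_card_sub_one_eq_one ha0) fun q hq hqp h1 => h q hq hqp ?_
  exact (ZMod.natCast_pow_eq_one_iff hp.one_lt a _).1 h1

theorem exists_of_hasSmallGenerator {p k a : ℕ} (hp : p.Prime) (ha : 0 < a)
    (h : hasSmallGenerator p k a = true) :
    ∃ b, 0 < b ∧ (b + 2) ^ 2 < p ∧ IsPrimitiveRootMod b p := by
  induction k generalizing a with
  | zero => simp [hasSmallGenerator] at h
  | succ k ih =>
    rw [hasSmallGenerator, Bool.or_eq_true, Bool.and_eq_true, Nat.blt_eq] at h
    obtain ⟨hlt, hf⟩ | h := h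
    · refine ⟨a, ha, by rwa [sq], isPrimitiveRootMod_of_pow_mod_ne_one hp ha (by nlinarith) ?_⟩
      intro q hq hqp
      have := of_allPrimeFactors pairwise_smallPrimes
        (fun d hd => (mem_smallPrimes.1 hd).2.pos) (fun d hd => (mem_smallPrimes.1 hd).1.le)
        (Nat.sub_pos_of_lt hp.one_lt) (fun r hr _ hrN => mem_smallPrimes.2 ⟨hrN, hr⟩) hf hq hqp
      intro heq
      simp [heq] at this
    · exact ih a.succ_pos h

/-- Either `n` fails the base-two Fermat test or it has a small generator. -/
def fermatOrGenerator (n : ℕ) : Bool :=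
  !Nat.beq (2 ^ (n - 1) % n) 1 || hasSmallGenerator n 50 2

theorem exists_of_fermatOrGenerator {p : ℕ} (hp : p.Prime) (hp2 : 2 < p)
    (h : fermatOrGenerator p = true) :
    ∃ b, 0 < b ∧ (b + 2) ^ 2 < p ∧ IsPrimitiveRootMod b p := by
  have := Fact.mk hp
  have hfermat : 2 ^ (p - 1) % p = 1 := by
    have h2 : ((2 : ℕ) : ZMod p) ≠ 0 := by
      rw [Ne, ZMod.natCast_eq_zero_iff]
      exact Nat.not_dvd_of_pos_of_lt two_pos hp2
    exact (ZMod.natCast_pow_eq_one_iff hp.one_lt 2 _).1 (ZMod.pow_card_sub_one_eq_one h2)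
  rw [fermatOrGenerator, hfermat, Nat.beq_refl] at h
  exact exists_of_hasSmallGenerator hp two_pos h

/-- `f` holds at the first `2 ^ k` terms of the progression `n, n + 2, n + 4, …`; the balanced
recursion keeps kernel evaluation shallow. -/
def allOddSteps (f : ℕ → Bool) : ℕ → ℕ → Bool
  | 0, n => f n
  | k + 1, n => allOddSteps f k n && allOddSteps f k (n + 2 * 2 ^ k)

theorem of_allOddSteps {f : ℕ → Bool} {k n i : ℕ} (h : allOddSteps f k n = true)
    (hi : i < 2 ^ k) : f (n + 2 * i) = true := by
  induction k generalizing n i with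
  | zero =>
    obtain rfl : i = 0 := by simpa using hi
    exact h
  | succ k ih =>
    rw [allOddSteps, Bool.and_eq_true] at h
    by_cases hik : i < 2 ^ k
    · exact ih h.1 hik
    · rw [pow_succ] at hi
      have := ih (i := i - 2 ^ k) h.2 (by omega)
      rwa [show n + 2 * 2 ^ k + 2 * (i - 2 ^ k) = n + 2 * i by omega] at this

theorem allOddSteps_fermatOrGenerator_from_411 :
    allOddSteps fermatOrGenerator 14 411 = true := by
  decide +kernel

theorem allOddSteps_fermatOrGenerator_from_33179 :
    allOddSteps fermatOrGenerator 14 33179 = true := by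
  decide +kernel

theorem allOddSteps_fermatOrGenerator_from_65947 :
    allOddSteps fermatOrGenerator 12 65947 = true := by
  decide +kernel

theorem fermatOrGenerator_of_odd {n : ℕ} (hodd : n % 2 = 1) (h1 : 409 < n) (h2 : n ≤ 71761) :
    fermatOrGenerator n = true := by
  have of_block {k s : ℕ} (h : allOddSteps fermatOrGenerator k s = true) (hs : s % 2 = 1)
      (hsn : s ≤ n) (hn : n < s + 2 * 2 ^ k) : fermatOrGenerator n = true := by
    have := of_allOddSteps (i := (n - s) / 2) h (by omega)
    rwa [show s + 2 * ((n - s) / 2) = n by omega] at this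
  by_cases h : n < 33179
  · exact of_block allOddSteps_fermatOrGenerator_from_411 rfl (by omega) (by omega)
  by_cases h' : n < 65947
  · exact of_block allOddSteps_fermatOrGenerator_from_33179 rfl (by omega) (by omega)
  · exact of_block allOddSteps_fermatOrGenerator_from_65947 rfl (by omega) (by omega)

theorem grosswald_finite_range (p : ℕ) (hp : Nat.Prime p)
    (h1 : 409 < p) (h2 : p ≤ 71761) :
    ∀ g : ℕ, IsLeastPrimitiveRootMod g p → (g : ℝ) < Real.sqrt p - 2 := by
  rintro g ⟨-, -, hleast⟩
  have hodd : p % 2 = 1 := hp.eq_two_or_odd.resolve_left (by omega)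
  obtain ⟨b, hb, hbp, hroot⟩ :=
    exists_of_fermatOrGenerator hp (by omega) (fermatOrGenerator_of_odd hodd h1 h2)
  have hgb : g ≤ b := by
    by_contra! hlt
    exact hleast b hb hlt hroot
  have hgp : (g + 2) ^ 2 < p := (Nat.pow_le_pow_left (by omega) 2).trans_lt hbp
  rw [lt_sub_iff_add_lt]
  exact Real.lt_sqrt_of_sq_lt (by exact_mod_cast hgp)
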